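/- arXiv:1610.03037 — 2 statements merged into one kernel-verified Lean document; each statement's English description precedes it below -/
import Mathlib

section
/- Let (G,·,1,d) be an abelian normed metric group, let n ∈ ℕ, x₁,…,xₙ ∈ G, and let E denote the uniform average over sign vectors ε ∈ {−1,1}ⁿ. Then for all q ∈ [1,2], ( E[ d(1, ∏ₖ xₖ^{εₖ})^q ] )^{1/q} ≤ 2^{1−1/q} · E[ d(1, ∏ₖ xₖ^{εₖ}) ]. -/
/-- The (unnormalised) Dirichlet energy of a function on the discrete cube. -/
def cubeEnergy {n : ℕ} (f : (Fin n → Bool) → ℝ) : ℝ :=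
  ∑ k, ∑ ε, (f ε - f (Function.update ε k (!ε k))) ^ 2

/-- The (unnormalised) first-level Fourier weight of a function on the discrete cube. -/
def cubeLevelOne {n : ℕ} (f : (Fin n → Bool) → ℝ) : ℝ :=
  ∑ k, (∑ ε, (if ε k then 1 else -1) * f ε) ^ 2

theorem sum_cube_succ {n : ℕ} (f : (Fin (n + 1) → Bool) → ℝ) :
    ∑ ε, f ε = ∑ ε : Fin n → Bool, (f (Fin.cons true ε) + f (Fin.cons false ε)) := by
  rw [← (Fin.consEquiv fun _ : Fin (n + 1) => Bool).sum_comp, Fintype.sum_prod_type]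
  simp [Fin.consEquiv, Finset.sum_add_distrib]

theorem cubeEnergy_nonneg {n : ℕ} (f : (Fin n → Bool) → ℝ) : 0 ≤ cubeEnergy f :=
  Finset.sum_nonneg fun _ _ => Finset.sum_nonneg fun _ _ => sq_nonneg _

section Succ

variable {n : ℕ} (f : (Fin (n + 1) → Bool) → ℝ)

theorem sum_sq_cube_succ :
    ∑ ε, f ε ^ 2 = (∑ ε : Fin n → Bool, (f (Fin.cons true ε) + f (Fin.cons false ε)) ^ 2
      + ∑ ε : Fin n → Bool, (f (Fin.cons true ε) - f (Fin.cons false ε)) ^ 2) / 2 := by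
  rw [sum_cube_succ, ← Finset.sum_add_distrib, Finset.sum_div]
  exact Finset.sum_congr rfl fun _ _ => by ring

theorem cubeEnergy_succ :
    cubeEnergy f = 2 * ∑ ε : Fin n → Bool, (f (Fin.cons true ε) - f (Fin.cons false ε)) ^ 2
      + (cubeEnergy (fun ε : Fin n → Bool => f (Fin.cons true ε) + f (Fin.cons false ε))
      + cubeEnergy (fun ε : Fin n → Bool => f (Fin.cons true ε) - f (Fin.cons false ε))) / 2 := by
  unfold cubeEnergy
  rw [Fin.sum_univ_succ]
  congr 1
  · rw [sum_cube_succ, Finset.mul_sum]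
    refine Finset.sum_congr rfl fun ε _ => ?_
    simp only [Fin.cons_zero, Fin.update_cons_zero, Bool.not_true, Bool.not_false]
    ring
  · rw [← Finset.sum_add_distrib, Finset.sum_div]
    refine Finset.sum_congr rfl fun k _ => ?_
    rw [sum_cube_succ, ← Finset.sum_add_distrib, Finset.sum_div]
    refine Finset.sum_congr rfl fun ε _ => ?_
    simp only [Fin.cons_succ, ← Fin.cons_update]
    ring

theorem cubeLevelOne_succ :
    cubeLevelOne f = (∑ ε : Fin n → Bool, (f (Fin.cons true ε) - f (Fin.cons false ε))) ^ 2
      + cubeLevelOne (fun ε : Fin n → Bool => f (Fin.cons true ε) + f (Fin.cons false ε)) := by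
  unfold cubeLevelOne
  rw [Fin.sum_univ_succ]
  congr 1
  · rw [sum_cube_succ]
    simp [sub_eq_add_neg]
  · refine Finset.sum_congr rfl fun k _ => ?_
    rw [sum_cube_succ]
    simp only [Fin.cons_succ, mul_add]

end Succ

/-- The Poincaré inequality on the discrete cube. -/
theorem cube_poincare {n : ℕ} (f : (Fin n → Bool) → ℝ) :
    2 ^ n * ∑ ε, f ε ^ 2 ≤ (∑ ε, f ε) ^ 2 + 2 ^ n * cubeEnergy f / 4 := by
  induction n with
  | zero => simp [cubeEnergy]
  | succ n ih =>
    have h := ih fun ε => f (Fin.cons true ε) + f (Fin.cons false ε)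
    have ht := mul_nonneg (pow_nonneg zero_le_two n) (cubeEnergy_nonneg fun ε : Fin n → Bool =>
      f (Fin.cons true ε) - f (Fin.cons false ε))
    rw [sum_sq_cube_succ, cubeEnergy_succ, sum_cube_succ f, pow_succ]
    linarith

/-- The Poincaré inequality with spectral gap two, up to the first Fourier level. -/
theorem cube_poincare_two {n : ℕ} (f : (Fin n → Bool) → ℝ) :
    2 * (2 ^ n * ∑ ε, f ε ^ 2)
      ≤ 2 * (∑ ε, f ε) ^ 2 + cubeLevelOne f + 2 ^ n * cubeEnergy f / 4 := by
  induction n with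
  | zero => simp [cubeEnergy, cubeLevelOne]
  | succ n ih =>
    have hs := ih fun ε => f (Fin.cons true ε) + f (Fin.cons false ε)
    have ht := cube_poincare fun ε : Fin n → Bool => f (Fin.cons true ε) - f (Fin.cons false ε)
    rw [sum_sq_cube_succ, cubeEnergy_succ, cubeLevelOne_succ, sum_cube_succ f, pow_succ]
    linarith

theorem cubeLevelOne_eq_zero_of_even {n : ℕ} (f : (Fin n → Bool) → ℝ)
    (hf : ∀ ε, f (fun k => !ε k) = f ε) : cubeLevelOne f = 0 := by
  refine Finset.sum_eq_zero fun k _ => ?_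
  have hinv : Function.Involutive fun (ε : Fin n → Bool) k => !ε k := fun ε => by simp
  have h : ∑ ε, (if ε k then (1 : ℝ) else -1) * f ε
      = -∑ ε, (if ε k then (1 : ℝ) else -1) * f ε := by
    rw [← Finset.sum_neg_distrib]
    refine Fintype.sum_equiv hinv.toPerm _ _ fun ε => ?_
    simp only [Function.Involutive.coe_toPerm, hf]
    by_cases h : ε k = true <;> simp [h]
  rw [sq_eq_zero_iff]
  linarith

theorem sum_cube_update_not {n : ℕ} (f : (Fin n → Bool) → ℝ) (k : Fin n) :
    ∑ ε, f (Function.update ε k (!ε k)) = ∑ ε, f ε := by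
  have hinv : Function.Involutive fun ε : Fin n → Bool => Function.update ε k (!ε k) :=
    fun ε => by simp
  exact Fintype.sum_equiv hinv.toPerm _ _ fun ε => rfl

/-- If flipping single signs decreases `f` by at most `2 f` in total, then the energy of `f` is
at most four times its square norm. -/
theorem cubeEnergy_le {n : ℕ} (f : (Fin n → Bool) → ℝ) (hf0 : ∀ ε, 0 ≤ f ε)
    (hf : ∀ ε, n * f ε ≤ 2 * f ε + ∑ k, f (Function.update ε k (!ε k))) :
    cubeEnergy f ≤ 4 * ∑ ε, f ε ^ 2 := by
  have h1 : cubeEnergy f = 2 * n * ∑ ε, f ε ^ 2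
      - 2 * ∑ ε, f ε * ∑ k, f (Function.update ε k (!ε k)) := by
    have hk : ∀ k, ∑ ε, (f ε - f (Function.update ε k (!ε k))) ^ 2
        = 2 * ∑ ε, f ε ^ 2 - 2 * ∑ ε, f ε * f (Function.update ε k (!ε k)) := fun k => by
      rw [two_mul (∑ ε, f ε ^ 2)]
      nth_rewrite 2 [← sum_cube_update_not (fun ε => f ε ^ 2) k]
      rw [Finset.mul_sum, ← Finset.sum_add_distrib, ← Finset.sum_sub_distrib]
      exact Finset.sum_congr rfl fun _ _ => by ring
    simp only [cubeEnergy, hk, Finset.sum_sub_distrib, Finset.mul_sum]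
    rw [Finset.sum_comm (s := Finset.univ (α := Fin n → Bool))]
    simp [Finset.mul_sum, mul_assoc, mul_left_comm]
  have h2 : n * ∑ ε, f ε ^ 2
      ≤ 2 * ∑ ε, f ε ^ 2 + ∑ ε, f ε * ∑ k, f (Function.update ε k (!ε k)) := by
    rw [Finset.mul_sum, Finset.mul_sum, ← Finset.sum_add_distrib]
    refine Finset.sum_le_sum fun ε _ => ?_
    nlinarith [mul_le_mul_of_nonneg_left (hf ε) (hf0 ε)]
  linarith

theorem prod_update_mul {G : Type*} [CommGroup G] {n : ℕ} (u : Fin n → Bool → G)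
    (ε : Fin n → Bool) (k : Fin n) (b : Bool) :
    (∏ j, u j (Function.update ε k b j)) * u k (ε k) = (∏ j, u j (ε j)) * u k b := by
  rw [← Finset.mul_prod_erase _ _ (Finset.mem_univ k),
    ← Finset.mul_prod_erase _ (fun j => u j (ε j)) (Finset.mem_univ k), Function.update_self,
    Finset.prod_congr rfl fun j hj => by rw [Function.update_of_ne (Finset.ne_of_mem_erase hj)]]
  simp only [mul_comm, mul_left_comm]

section Metric

variable {G : Type*} [CommGroup G] [MetricSpace G]

theorem dist_one_mul_le (hinv : ∀ a b c : G, dist (a * c) (b * c) = dist a b) (a b : G) :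
    dist 1 (a * b) ≤ dist 1 a + dist 1 b := by
  have h := hinv 1 a b
  rw [one_mul] at h
  linarith [dist_triangle 1 b (a * b)]

theorem dist_one_inv_of_invariant (hinv : ∀ a b c : G, dist (a * c) (b * c) = dist a b) (a : G) :
    dist 1 a⁻¹ = dist 1 a := by
  have h := hinv 1 a⁻¹ a
  rw [one_mul, inv_mul_cancel] at h
  rw [← h, dist_comm]

theorem dist_one_prod_le (hinv : ∀ a b c : G, dist (a * c) (b * c) = dist a b)
    {ι : Type*} (s : Finset ι) (g : ι → G) : dist 1 (∏ i ∈ s, g i) ≤ ∑ i ∈ s, dist 1 (g i) := by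
  classical
  induction s using Finset.induction_on with
  | empty => simp
  | insert i s hi ih =>
    rw [Finset.prod_insert hi, Finset.sum_insert hi]
    linarith [dist_one_mul_le hinv (g i) (∏ i ∈ s, g i)]

/-- The sharp Khinchin–Kahane inequality between the first and the second moment. -/
theorem khinchin_kahane_sq (hinv : ∀ a b c : G, dist (a * c) (b * c) = dist a b)
    (hnormed : ∀ (z : G) (m : ℕ), dist (1 : G) (z ^ m) = m * dist (1 : G) z)
    {n : ℕ} (u : Fin n → Bool → G) (hu : ∀ k b, u k (!b) = (u k b)⁻¹) :
    2 ^ n * ∑ ε : Fin n → Bool, dist 1 (∏ k, u k (ε k)) ^ 2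
      ≤ 2 * (∑ ε : Fin n → Bool, dist 1 (∏ k, u k (ε k))) ^ 2 := by
  set f : (Fin n → Bool) → ℝ := fun ε => dist 1 (∏ k, u k (ε k)) with hf
  have heven : ∀ ε, f (fun k => !ε k) = f ε := fun ε => by
    simp only [hf, hu, Finset.prod_inv_distrib, dist_one_inv_of_invariant hinv]
  have hflip : ∀ ε, n * f ε ≤ 2 * f ε + ∑ k, f (Function.update ε k (!ε k)) := fun ε => by
    have hprod : (∏ j, u j (ε j)) ^ n
        = (∏ j, u j (ε j)) ^ 2 * ∏ k, ∏ j, u j (Function.update ε k (!ε k) j) := by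
      have hk : ∀ k, ∏ j, u j (Function.update ε k (!ε k) j)
          = (∏ j, u j (ε j)) * (u k (ε k))⁻¹ ^ 2 := fun k => by
        rw [eq_mul_inv_of_mul_eq (prod_update_mul u ε k (!ε k)), hu, mul_assoc, sq]
      simp only [hk, Finset.prod_mul_distrib, Finset.prod_const, Finset.card_univ,
        Fintype.card_fin, Finset.prod_pow, Finset.prod_inv_distrib]
      rw [inv_pow, mul_comm, inv_mul_cancel_right]
    calc n * f ε = dist 1 ((∏ j, u j (ε j)) ^ n) := (hnormed _ _).symm
      _ ≤ dist 1 ((∏ j, u j (ε j)) ^ 2)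
          + dist 1 (∏ k, ∏ j, u j (Function.update ε k (!ε k) j)) := by
        rw [hprod]
        exact dist_one_mul_le hinv _ _
      _ ≤ _ := by
        rw [hnormed]
        exact add_le_add le_rfl (dist_one_prod_le hinv _ _)
  have h1 := cube_poincare_two f
  have h2 := mul_le_mul_of_nonneg_left (cubeEnergy_le f (fun _ => dist_nonneg) hflip)
    (pow_nonneg (zero_le_two (α := ℝ)) n)
  rw [cubeLevelOne_eq_zero_of_even f heven] at h1
  linarith

end Metric

theorem rpow_le_of_mem_Icc {y q : ℝ} (hy : 0 ≤ y) (hq1 : 1 ≤ q) (hq2 : q ≤ 2) :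
    y ^ q ≤ 2 ^ (q - 1) * ((2 - q) * y + (q - 1) * (y ^ 2 / 2)) := by
  have h := Real.geom_mean_le_arith_mean2_weighted (sub_nonneg.2 hq2) (sub_nonneg.2 hq1) hy
    (by positivity : 0 ≤ y ^ 2 / 2) (by ring)
  refine le_of_eq_of_le ?_ (mul_le_mul_of_nonneg_left h (by positivity))
  rw [Real.div_rpow (by positivity) zero_le_two, ← Real.rpow_natCast_mul hy, ← mul_div_assoc,
    mul_div_cancel₀ _ (by positivity), ← Real.rpow_add_of_nonneg hy (by linarith)
    (by push_cast; linarith)]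
  congr 1
  push_cast
  ring

/-- Interpolation: a comparison of the second with the first moment yields a comparison of the
`q`-th with the first moment for `q ∈ [1, 2]`. -/
theorem moment_comparison_interpolation {ι : Type*} [Fintype ι] (X : ι → ℝ) (hX : ∀ i, 0 ≤ X i)
    {N q : ℝ} (hN : 0 < N) (hq1 : 1 ≤ q) (hq2 : q ≤ 2)
    (h : N * ∑ i, X i ^ 2 ≤ 2 * (∑ i, X i) ^ 2) :
    ((∑ i, X i ^ q) / N) ^ (1 / q) ≤ 2 ^ (1 - 1 / q) * ((∑ i, X i) / N) := by
  have hq0 : 0 < q := by linarith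
  rcases (Finset.sum_nonneg fun i _ => hX i : 0 ≤ ∑ i, X i).eq_or_lt with h0 | hpos
  · have hXi : ∀ i, X i = 0 := fun i =>
      (Finset.sum_eq_zero_iff_of_nonneg fun i _ => hX i).1 h0.symm i (Finset.mem_univ i)
    simp [hXi, hq0.ne']
  set m := (∑ i, X i) / N with hm
  have hmpos : 0 < m := div_pos hpos hN
  have hsum : ∑ i, X i = m * N := by rw [hm]; field_simp
  have hsq : ∑ i, X i ^ 2 ≤ 2 * m ^ 2 * N := by
    rw [hsum] at h
    exact le_of_mul_le_mul_left (by linarith) hN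
  have hkey : (∑ i, X i ^ q) / N ≤ 2 ^ (q - 1) * m ^ q := by
    rw [div_le_iff₀ hN]
    calc ∑ i, X i ^ q
        ≤ ∑ i, m ^ q * (2 ^ (q - 1) * ((2 - q) * (X i / m) + (q - 1) * ((X i / m) ^ 2 / 2))) := by
          refine Finset.sum_le_sum fun i _ => ?_
          have hi := rpow_le_of_mem_Icc (div_nonneg (hX i) hmpos.le) hq1 hq2
          rwa [Real.div_rpow (hX i) hmpos.le, div_le_iff₀' (by positivity)] at hi
      _ = m ^ q * 2 ^ (q - 1) * ((2 - q) / m * ∑ i, X i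
          + (q - 1) / (2 * m ^ 2) * ∑ i, X i ^ 2) := by
          rw [Finset.mul_sum, Finset.mul_sum, ← Finset.sum_add_distrib, Finset.mul_sum]
          refine Finset.sum_congr rfl fun i _ => ?_
          field_simp
      _ ≤ m ^ q * 2 ^ (q - 1) * ((2 - q) / m * (m * N)
          + (q - 1) / (2 * m ^ 2) * (2 * m ^ 2 * N)) := by
          rw [hsum]
          have : 0 ≤ q - 1 := by linarith
          gcongr
      _ = 2 ^ (q - 1) * m ^ q * N := by
          field_simp
          ring
  calc ((∑ i, X i ^ q) / N) ^ (1 / q) ≤ (2 ^ (q - 1) * m ^ q) ^ (1 / q) :=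
        Real.rpow_le_rpow (div_nonneg (Finset.sum_nonneg fun i _ => Real.rpow_nonneg (hX i) q)
          hN.le) hkey (by positivity)
    _ = 2 ^ (1 - 1 / q) * m := by
        rw [Real.mul_rpow (by positivity) (by positivity), ← Real.rpow_mul zero_le_two,
          ← Real.rpow_mul hmpos.le, mul_one_div_cancel hq0.ne', Real.rpow_one, sub_mul,
          mul_one_div_cancel hq0.ne', one_mul]


/-- Sharp Khinchin–Kahane inequality, `p = 1 ≤ q ≤ 2`, for abelian normed
metric groups: `(E[d(1,∏ xₖ^{εₖ})^q])^{1/q} ≤ 2^{1−1/q} · E[d(1,∏ xₖ^{εₖ})]`. -/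
theorem khinchin_kahane_sharp
    (G : Type*) [CommGroup G] [MetricSpace G]
    (hinv : ∀ a b c : G, dist (a * c) (b * c) = dist a b)
    (hnormed : ∀ (z : G) (m : ℕ), dist (1 : G) (z ^ m) = m * dist (1 : G) z)
    (n : ℕ) (x : Fin n → G) (q : ℝ) (hq1 : 1 ≤ q) (hq2 : q ≤ 2) :
    ((∑ ε : Fin n → Bool,
        dist (1 : G) (∏ k, x k ^ (if ε k then (1 : ℤ) else -1)) ^ q) / 2 ^ n) ^ (1 / q)
      ≤ 2 ^ (1 - 1 / q) *
        ((∑ ε : Fin n → Bool,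
          dist (1 : G) (∏ k, x k ^ (if ε k then (1 : ℤ) else -1))) / 2 ^ n) := by
  refine moment_comparison_interpolation _ (fun _ => dist_nonneg) (by positivity) hq1 hq2 ?_
  refine khinchin_kahane_sq hinv hnormed (fun k b => x k ^ (if b then (1 : ℤ) else -1)) ?_
  intro k b
  cases b <;> simp
end

section
/- Let (G,·,1,d) be a separable abelian metric group, n ∈ ℕ, x₁,…,xₙ ∈ G, and let ε be uniformly distributed on {−1,1}ⁿ (independent Rademacher signs). Write Pₙ(ε) := d(1, ∏ₖ xₖ^{εₖ}). Then for all s, t, u, v > 0: ℙ( d(1, ∏ₖ xₖ^{2εₖ}) > s + t + u + v ) ≤ ( ℙ(Pₙ > s) + ℙ(Pₙ > t) ) · ( ℙ(Pₙ > u) + ℙ(Pₙ > v) ). -/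
/-- The average of `f (g * ∏ₖ xₖ^{εₖ})` over all signs `ε`, where `l = [x₁, …, xₙ]`. -/
noncomputable def signAvg {G : Type*} [CommGroup G] : List G → (G → ℝ) → G → ℝ
  | [], f, g => f g
  | x :: l, f, g => (signAvg l f (g * x) + signAvg l f (g * x⁻¹)) / 2

/-- The probability that the random walk `g, g * x₁^{ε₁}, g * x₁^{ε₁} * x₂^{ε₂}, …` visits `p`. -/
noncomputable def hitProb {G : Type*} [CommGroup G] (p : G → Prop) [DecidablePred p] :
    List G → G → ℝ
  | [], g => if p g then 1 else 0
  | x :: l, g => if p g then 1 else (hitProb p l (g * x) + hitProb p l (g * x⁻¹)) / 2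

section SignAvg

variable {G : Type*} [CommGroup G]

theorem signAvg_mono {f₁ f₂ : G → ℝ} (h : ∀ y, f₁ y ≤ f₂ y) (l : List G) (g : G) :
    signAvg l f₁ g ≤ signAvg l f₂ g := by
  induction l generalizing g with
  | nil => exact h g
  | cons x l ih => simp only [signAvg]; linarith [ih (g * x), ih (g * x⁻¹)]

theorem signAvg_const (c : ℝ) (l : List G) (g : G) : signAvg l (fun _ => c) g = c := by
  induction l generalizing g with
  | nil => rfl
  | cons x l ih => simp only [signAvg, ih]; ring

theorem signAvg_add (f₁ f₂ : G → ℝ) (l : List G) (g : G) :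
    signAvg l (fun y => f₁ y + f₂ y) g = signAvg l f₁ g + signAvg l f₂ g := by
  induction l generalizing g with
  | nil => rfl
  | cons x l ih => simp only [signAvg, ih]; ring

theorem signAvg_mul_left (f : G → ℝ) (l : List G) (h g : G) :
    signAvg l f (h * g) = signAvg l (fun y => f (h * y)) g := by
  induction l generalizing g with
  | nil => rfl
  | cons x l ih => simp only [signAvg, mul_assoc, ih]

theorem signAvg_comp_inv (f : G → ℝ) (l : List G) (g : G) :
    signAvg l (fun y => f y⁻¹) g = signAvg l f g⁻¹ := by
  induction l generalizing g with
  | nil => rfl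
  | cons x l ih => simp only [signAvg, ih, mul_inv, inv_inv]; ring

theorem sum_div_two_pow_eq_signAvg (f : G → ℝ) (n : ℕ) (x : Fin n → G) (g : G) :
    (∑ ε : Fin n → Bool, f (g * ∏ k, x k ^ (if ε k then (1 : ℤ) else -1))) / 2 ^ n =
      signAvg (List.ofFn x) f g := by
  induction n generalizing g with
  | zero => simp [signAvg]
  | succ n ih =>
    rw [← (Fin.consEquiv fun _ : Fin (n + 1) => Bool).sum_comp, Fintype.sum_prod_type]
    simp only [List.ofFn_succ, signAvg, ← ih, Fintype.sum_bool, Fin.consEquiv, Equiv.coe_fn_mk,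
      Fin.prod_univ_succ, Fin.cons_zero, Fin.cons_succ, if_true, zpow_one, Bool.false_eq_true,
      if_false, zpow_neg, mul_assoc]
    ring

theorem hitProb_of_pos {p : G → Prop} [DecidablePred p] {g : G} (hg : p g) (l : List G) :
    hitProb p l g = 1 := by
  cases l <;> simp [hitProb, hg]

variable {N : G → ℝ}

/-- Lévy's reflection bound for a walk started at `g` with `N (g ^ 2) > s + t`. -/
theorem one_le_signAvg_add (hmul : ∀ a b, N (a * b) ≤ N a + N b) {s t : ℝ} {g : G}
    (hg : s + t < N (g ^ 2)) (l : List G) :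
    1 ≤ signAvg l (fun y => if s < N y then 1 else 0) g +
      signAvg l (fun y => if t < N y then 1 else 0) g := by
  have hreflect : signAvg l (fun y => if t < N y then (1 : ℝ) else 0) g =
      signAvg l (fun y => if t < N (g * y⁻¹) then (1 : ℝ) else 0) 1 := by
    rw [signAvg_comp_inv (fun y => if t < N (g * y) then (1 : ℝ) else 0), inv_one,
      ← signAvg_mul_left (fun y => if t < N y then (1 : ℝ) else 0), mul_one]
  have htranslate : signAvg l (fun y => if s < N y then (1 : ℝ) else 0) g =
      signAvg l (fun y => if s < N (g * y) then (1 : ℝ) else 0) 1 := by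
    rw [← signAvg_mul_left (fun y => if s < N y then (1 : ℝ) else 0), mul_one]
  rw [hreflect, htranslate, ← signAvg_add]
  refine (signAvg_const 1 l (1 : G)).symm.le.trans (signAvg_mono (fun y => ?_) l 1)
  have h := hmul (g * y) (g * y⁻¹)
  rw [show g * y * (g * y⁻¹) = g ^ 2 by rw [mul_mul_mul_comm, mul_inv_cancel, mul_one, sq]] at h
  split_ifs <;> linarith

/-- Lévy's maximal inequality. -/
theorem hitProb_le (hmul : ∀ a b, N (a * b) ≤ N a + N b) (s t : ℝ) (l : List G) (g : G) :
    hitProb (fun y => s + t < N (y ^ 2)) l g ≤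
      signAvg l (fun y => if s < N y then 1 else 0) g +
        signAvg l (fun y => if t < N y then 1 else 0) g := by
  induction l generalizing g with
  | nil =>
    by_cases hg : s + t < N (g ^ 2)
    · rw [hitProb_of_pos (p := fun y => s + t < N (y ^ 2)) hg]
      exact one_le_signAvg_add hmul hg []
    · simp only [hitProb, signAvg, if_neg hg]
      split_ifs <;> norm_num
  | cons x l ih =>
    by_cases hg : s + t < N (g ^ 2)
    · rw [hitProb_of_pos (p := fun y => s + t < N (y ^ 2)) hg]
      exact one_le_signAvg_add hmul hg _
    · simp only [hitProb, signAvg, if_neg hg]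
      linarith [ih (g * x), ih (g * x⁻¹)]

theorem signAvg_sq_le (hmul : ∀ a b, N (a * b) ≤ N a + N b) (hN : ∀ a, N a⁻¹ = N a) (u v : ℝ)
    (l : List G) (g : G) :
    signAvg l (fun y => if u + v < N (y ^ 2) then 1 else 0) 1 ≤
      signAvg l (fun y => if u < N y then 1 else 0) g +
        signAvg l (fun y => if v < N y then 1 else 0) g := by
  have hreflect : signAvg l (fun y => if v < N y then (1 : ℝ) else 0) g =
      signAvg l (fun y => if v < N (g⁻¹ * y) then (1 : ℝ) else 0) 1 := by
    rw [← signAvg_mul_left (fun y => if v < N y then (1 : ℝ) else 0), mul_one,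
      ← signAvg_comp_inv]
    simp only [hN]
  have htranslate : signAvg l (fun y => if u < N y then (1 : ℝ) else 0) g =
      signAvg l (fun y => if u < N (g * y) then (1 : ℝ) else 0) 1 := by
    rw [← signAvg_mul_left (fun y => if u < N y then (1 : ℝ) else 0), mul_one]
  rw [hreflect, htranslate, ← signAvg_add]
  refine signAvg_mono (fun y => ?_) l 1
  have h := hmul (g * y) (g⁻¹ * y)
  rw [show g * y * (g⁻¹ * y) = y ^ 2 by rw [mul_mul_mul_comm, mul_inv_cancel, one_mul, sq]] at h
  split_ifs <;> linarith

theorem signAvg_le_of_suffix {f : G → ℝ} {c : ℝ} {l' l : List G} (h : l' <:+ l)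
    (hc : ∀ g, c ≤ signAvg l' f g) (g : G) : c ≤ signAvg l f g := by
  induction l generalizing g with
  | nil => rw [List.suffix_nil.mp h] at hc; exact hc g
  | cons x l ih =>
    rcases List.suffix_cons_iff.mp h with rfl | h
    · exact hc g
    · simp only [signAvg]
      linarith [ih h (g * x), ih h (g * x⁻¹)]

/-- After the squared walk first exceeds `a`, exceeding `a + b` forces the squared tail, including
the step at which `a` was exceeded, to exceed `b`. -/
theorem signAvg_sq_le_hitProb_mul (hmul : ∀ a b, N (a * b) ≤ N a + N b)
    (hN : ∀ a, N a⁻¹ = N a) {a b c : ℝ} (hb : 0 ≤ b) {l : List G}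
    (hc : ∀ l', l' <:+ l → signAvg l' (fun y => if b < N (y ^ 2) then 1 else 0) 1 ≤ c)
    {g : G} (hg : N (g ^ 2) ≤ a) :
    signAvg l (fun y => if a + b < N (y ^ 2) then 1 else 0) g ≤
      hitProb (fun y => a < N (y ^ 2)) l g * c := by
  induction l generalizing g with
  | nil =>
    simp [signAvg, hitProb, hg.not_gt, (hg.trans (le_add_of_nonneg_right hb)).not_gt]
  | cons x l ih =>
    let F : G → ℝ := fun y => if b < N (y ^ 2) then 1 else 0
    have hF : ∀ y, F y⁻¹ = F y := fun y => by simp only [F, inv_pow, hN]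
    have hsymm : signAvg l F x⁻¹ = signAvg l F x := by
      rw [← signAvg_comp_inv]; simp only [hF]
    have hcx : signAvg l F x ≤ c := by
      have h := hc (x :: l) List.suffix_rfl
      simp only [signAvg, one_mul] at h
      change (signAvg l F x + signAvg l F x⁻¹) / 2 ≤ c at h
      linarith
    have step : ∀ z, signAvg l F z ≤ c →
        signAvg l (fun y => if a + b < N (y ^ 2) then 1 else 0) (g * z) ≤
          hitProb (fun y => a < N (y ^ 2)) l (g * z) * c := fun z hz => by
      by_cases h : a < N ((g * z) ^ 2)
      · rw [hitProb_of_pos (p := fun y => a < N (y ^ 2)) h, one_mul, signAvg_mul_left]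
        refine (signAvg_mono (fun y => ?_) l z).trans hz
        have := hmul (g ^ 2) (y ^ 2)
        simp only [F, mul_pow]
        split_ifs <;> linarith
      · exact ih (fun l' hl' => hc l' (hl'.trans (List.suffix_cons x l))) (not_lt.mp h)
    simp only [signAvg, hitProb, if_neg hg.not_gt]
    linarith [step x hcx, step x⁻¹ (hsymm.trans_le hcx)]

end SignAvg


/-- For a separable abelian metric group `G` and independent Rademacher
signs (uniform on `{−1,1}ⁿ`), with `Pₙ(ε) = d(1, ∏ₖ xₖ^{εₖ})`:
`ℙ(d(1, ∏ₖ xₖ^{2εₖ}) > s+t+u+v) ≤ (ℙ(Pₙ > s) + ℙ(Pₙ > t))·(ℙ(Pₙ > u) + ℙ(Pₙ > v))`,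
where `ℙ(A) = 2⁻ⁿ·#{ε : ε ∈ A}` is encoded as an average of indicators. -/
theorem levy_application_rademacher
    (G : Type*) [CommGroup G] [MetricSpace G] [TopologicalSpace.SeparableSpace G]
    (hinv : ∀ a b c : G, dist (a * c) (b * c) = dist a b)
    (n : ℕ) (x : Fin n → G) (s t u v : ℝ) (hs : 0 < s) (ht : 0 < t) (hu : 0 < u) (hv : 0 < v) :
    (∑ ε : Fin n → Bool,
        if s + t + u + v < dist (1 : G) (∏ k, x k ^ (2 * (if ε k then (1 : ℤ) else -1)))
        then (1 : ℝ) else 0) / 2 ^ n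
      ≤ ((∑ ε : Fin n → Bool,
            if s < dist (1 : G) (∏ k, x k ^ (if ε k then (1 : ℤ) else -1))
            then (1 : ℝ) else 0) / 2 ^ n
          + (∑ ε : Fin n → Bool,
            if t < dist (1 : G) (∏ k, x k ^ (if ε k then (1 : ℤ) else -1))
            then (1 : ℝ) else 0) / 2 ^ n)
        * ((∑ ε : Fin n → Bool,
            if u < dist (1 : G) (∏ k, x k ^ (if ε k then (1 : ℤ) else -1))
            then (1 : ℝ) else 0) / 2 ^ n
          + (∑ ε : Fin n → Bool,
            if v < dist (1 : G) (∏ k, x k ^ (if ε k then (1 : ℤ) else -1))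
            then (1 : ℝ) else 0) / 2 ^ n) := by
  have hmul : ∀ a b : G, dist 1 (a * b) ≤ dist 1 a + dist 1 b := fun a b => by
    have h := hinv 1 b a
    rw [one_mul, mul_comm b a] at h
    rw [← h]
    exact dist_triangle _ _ _ |>.trans_eq (by ring)
  have hN : ∀ a : G, dist 1 a⁻¹ = dist 1 a := fun a => by
    rw [← hinv 1 a⁻¹ a, one_mul, inv_mul_cancel, dist_comm]
  have hsum : ∀ r : ℝ, (∑ ε : Fin n → Bool,
      if r < dist (1 : G) (∏ k, x k ^ (if ε k then (1 : ℤ) else -1)) then (1 : ℝ) else 0) / 2 ^ n =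
        signAvg (List.ofFn x) (fun y => if r < dist 1 y then 1 else 0) 1 := fun r => by
    simp only [← sum_div_two_pow_eq_signAvg, one_mul]
  have hsum_sq : (∑ ε : Fin n → Bool,
      if s + t + u + v < dist (1 : G) (∏ k, x k ^ (2 * (if ε k then (1 : ℤ) else -1)))
        then (1 : ℝ) else 0) / 2 ^ n =
        signAvg (List.ofFn x) (fun y => if s + t + (u + v) < dist 1 (y ^ 2) then 1 else 0) 1 := by
    simp only [← sum_div_two_pow_eq_signAvg, one_mul, ← Finset.prod_pow, ← add_assoc,
      mul_comm (2 : ℤ), zpow_mul, zpow_ofNat]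
  rw [hsum_sq, hsum, hsum, hsum, hsum]
  have hc : ∀ l', l' <:+ List.ofFn x →
      signAvg l' (fun y => if u + v < dist 1 (y ^ 2) then 1 else 0) 1 ≤
        signAvg (List.ofFn x) (fun y => if u < dist 1 y then 1 else 0) 1 +
          signAvg (List.ofFn x) (fun y => if v < dist 1 y then 1 else 0) 1 := fun l' hl' => by
    rw [← signAvg_add]
    refine signAvg_le_of_suffix hl' (fun g => ?_) 1
    rw [signAvg_add]
    exact signAvg_sq_le hmul hN u v l' g
  have hnonneg : ∀ r : ℝ,
      0 ≤ signAvg (List.ofFn x) (fun y => if r < dist 1 y then 1 else 0) 1 := fun r =>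
    (signAvg_const 0 (List.ofFn x) 1).symm.le.trans
      (signAvg_mono (fun y => by split_ifs <;> simp) _ _)
  refine (signAvg_sq_le_hitProb_mul hmul hN (by positivity) hc
    (by rw [one_pow, dist_self]; positivity)).trans ?_
  exact mul_le_mul_of_nonneg_right (hitProb_le hmul s t _ 1) (add_nonneg (hnonneg u) (hnonneg v))
end
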